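/- Let T be a skeletally small Hom-finite Krull-Schmidt R-linear triangulated category. Then T has Serre duality if and only if T is a dualizing R-variety. -/

import Mathlib

open CategoryTheory CategoryTheory.Limits CategoryTheory.Linear
open CategoryTheory.Pretriangulated ZeroObject

universe w v u

namespace GeneralizedSerreDuality

/-- `E` is a minimal injective cogenerator for the commutative ring `R`. -/
structure IsMinimalInjectiveCogenerator (R : Type u) [CommRing R]
    (E : Type u) [AddCommGroup E] [Module R E] : Prop where
  injective : Module.Injective R E
  cogenerates : ∀ (M : Type u) [AddCommGroup M] [Module R M] (m : M), m ≠ 0 →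
    ∃ f : M →ₗ[R] E, f m ≠ 0
  minimal : ∀ (E' : Type u) [AddCommGroup E'] [Module R E'], Module.Injective R E' →
    (∀ (M : Type u) [AddCommGroup M] [Module R M] (m : M), m ≠ 0 →
      ∃ f : M →ₗ[R] E', f m ≠ 0) →
    ∃ g : E →ₗ[R] E', Function.Injective g

section
variable (R : Type u) [CommRing R] (E : Type u) [AddCommGroup E] [Module R E]
variable {C : Type v} [Category.{w} C] [Preadditive C] [CategoryTheory.Linear R C]

/-- `X ∈ C_r`: `D Hom(X, -)` is representable. -/
def MemR (X : C) : Prop :=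
  ∃ (SX : C) (φ : ∀ Y : C, ((X ⟶ Y) →ₗ[R] E) ≃ₗ[R] (Y ⟶ SX)),
    ∀ ⦃Y Y' : C⦄ (g : Y ⟶ Y') (ψ : (X ⟶ Y') →ₗ[R] E),
      φ Y (ψ ∘ₗ Linear.rightComp R X g) = g ≫ φ Y' ψ

/-- The contravariant functor `D Hom(X, -)` is coherent: there are objects `C₀, C₁` and an
exact sequence of functors `(-, C₀) → (-, C₁) → D Hom(X, -) → 0`,
given pointwise by a natural family of additive maps. -/
def DHomRightCoherent (X : C) : Prop :=
  ∃ (C₀ C₁ : C) (f : C₀ ⟶ C₁) (π : ∀ Y : C, (Y ⟶ C₁) →+ ((X ⟶ Y) →ₗ[R] E)),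
    (∀ ⦃Y Y' : C⦄ (g : Y' ⟶ Y) (h : Y ⟶ C₁),
      π Y' (g ≫ h) = (π Y h) ∘ₗ Linear.rightComp R X g) ∧
    (∀ Y : C, Function.Exact (fun h : Y ⟶ C₀ => h ≫ f) (π Y)) ∧
    (∀ Y : C, Function.Surjective (π Y))

/-- `X ∈ C_l`: `D Hom(-, X)` is representable. -/
def MemL (X : C) : Prop :=
  ∃ (TX : C) (φ : ∀ Y : C, ((Y ⟶ X) →ₗ[R] E) ≃ₗ[R] (TX ⟶ Y)),
    ∀ ⦃Y Y' : C⦄ (g : Y ⟶ Y') (ψ : (Y ⟶ X) →ₗ[R] E),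
      φ Y' (ψ ∘ₗ Linear.leftComp R X g) = φ Y ψ ≫ g

/-- The covariant functor `D Hom(-, X)` is coherent: there are objects `C₀, C₁` and an
exact sequence of functors `(C₁, -) → (C₀, -) → D Hom(-, X) → 0`. -/
def DHomLeftCoherent (X : C) : Prop :=
  ∃ (C₀ C₁ : C) (f : C₀ ⟶ C₁) (π : ∀ Y : C, (C₀ ⟶ Y) →+ ((Y ⟶ X) →ₗ[R] E)),
    (∀ ⦃Y Y' : C⦄ (g : Y ⟶ Y') (h : C₀ ⟶ Y),
      π Y' (h ≫ g) = (π Y h) ∘ₗ Linear.leftComp R X g) ∧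
    (∀ Y : C, Function.Exact (fun h : C₁ ⟶ Y => f ≫ h) (π Y)) ∧
    (∀ Y : C, Function.Surjective (π Y))

/-- `k : K ⟶ A` is a pseudokernel of `f : A ⟶ B`. -/
def IsPseudokernel {K A B : C} (k : K ⟶ A) (f : A ⟶ B) : Prop :=
  k ≫ f = 0 ∧ ∀ ⦃K' : C⦄ (k' : K' ⟶ A), k' ≫ f = 0 → ∃ t : K' ⟶ K, t ≫ k = k'

/-- `c : B ⟶ Q` is a pseudocokernel of `f : A ⟶ B`. -/
def IsPseudocokernel {A B Q : C} (f : A ⟶ B) (c : B ⟶ Q) : Prop :=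
  f ≫ c = 0 ∧ ∀ ⦃Q' : C⦄ (c' : B ⟶ Q'), f ≫ c' = 0 → ∃ t : Q ⟶ Q', c ≫ t = c'

end

/-- An additive category is Krull-Schmidt if every object is a finite direct sum of
objects with local endomorphism rings. -/
def IsKrullSchmidt (C : Type v) [Category.{w} C] [Preadditive C]
    [HasFiniteBiproducts C] : Prop :=
  ∀ X : C, ∃ (n : ℕ) (f : Fin n → C),
    Nonempty (X ≅ ⨁ f) ∧ ∀ i, IsLocalRing (End (f i))

section IdempotentSplitting

variable {C : Type v} [Category.{w} C] [Preadditive C]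

/-- The idempotent `e` splits. -/
def Splits {X : C} (e : X ⟶ X) : Prop :=
  ∃ (Y : C) (i : Y ⟶ X) (q : X ⟶ Y), i ≫ q = 𝟙 Y ∧ q ≫ i = e

lemma Splits.add [HasBinaryBiproducts C] {X : C} {e f : X ⟶ X} (he : Splits e) (hf : Splits f)
    (hef : e ≫ f = 0) (hfe : f ≫ e = 0) : Splits (e + f) := by
  obtain ⟨Y, i, q, h, rfl⟩ := he
  obtain ⟨Z, j, r, h', rfl⟩ := hf
  have hij : i ≫ r = 0 := by
    have := i ≫= hef =≫ r
    simpa [reassoc_of% h, h'] using this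
  have hji : j ≫ q = 0 := by
    have := j ≫= hfe =≫ q
    simpa [reassoc_of% h', h] using this
  exact ⟨Y ⊞ Z, biprod.desc i j, biprod.lift q r, by ext <;> simp [h, h', hij, hji], by simp⟩

/-- If `e` is an idempotent of the direct sum of `A` and `B` whose component `A ⟶ A` is invertible,
then the splitting of `e` and of `1 - e` reduces to the splitting of idempotents of `B`. -/
lemma splits_and_splits_of_isIso [HasBinaryBiproducts C] {X A B : C}
    {ι : A ⟶ X} {p : X ⟶ A} {ι' : B ⟶ X} {p' : X ⟶ B}
    (hι'p : ι' ≫ p = 0) (hι'p' : ι' ≫ p' = 𝟙 B)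
    (total : p ≫ ι + p' ≫ ι' = 𝟙 X) (hB : ∀ e : B ⟶ B, e ≫ e = e → Splits e)
    {e : X ⟶ X} (he : e ≫ e = e) [IsIso (ι ≫ e ≫ p)] : Splits e ∧ Splits (𝟙 X - e) := by
  obtain ⟨v, hv, hv'⟩ : ∃ v, ι ≫ e ≫ p ≫ v = 𝟙 A ∧ v ≫ ι ≫ e ≫ p = 𝟙 A :=
    ⟨inv (ι ≫ e ≫ p), by rw [← IsIso.hom_inv_id (ι ≫ e ≫ p)]; simp only [Category.assoc], by simp⟩
  let f : X ⟶ X := e ≫ p ≫ v ≫ ι ≫ e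
  let j : B ⟶ X := ι' ≫ (𝟙 X - f)
  let q : X ⟶ B := (𝟙 X - p ≫ v ≫ ι ≫ e) ≫ p'
  have hf : Splits f := ⟨A, ι ≫ e, e ≫ p ≫ v, by simp [reassoc_of% he, hv], by simp [f]⟩
  have hef : e ≫ f = f := by simp [f, reassoc_of% he]
  have hfe : f ≫ e = f := by simp [f, he]
  have hff : f ≫ f = f := by simp [f, reassoc_of% he, reassoc_of% hv]
  have hjq : j ≫ q = 𝟙 B := by
    simp [j, q, f, hι'p', reassoc_of% hι'p, reassoc_of% hv]
  have hqj : q ≫ j = 𝟙 X - f := by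
    have h : p' ≫ ι' = 𝟙 X - p ≫ ι := eq_sub_of_add_eq' total
    simp [j, q, f, h, reassoc_of% h, reassoc_of% he, reassoc_of% hv, reassoc_of% hv']
  have transport {h : X ⟶ X} (hh : h ≫ h = h) (hfh : f ≫ h = 0) (hhf : h ≫ f = 0) :
      Splits h := by
    have hqj' : q ≫ j ≫ h = h := by rw [reassoc_of% hqj]; simp [hfh]
    have hqj'' : h ≫ q ≫ j = h := by rw [hqj]; simp [hhf]
    obtain ⟨Y, i, r, hir, hri⟩ := hB (j ≫ h ≫ q) (by
      simp only [Category.assoc, reassoc_of% hqj', reassoc_of% hh])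
    refine ⟨Y, i ≫ j, q ≫ r, by simp [reassoc_of% hjq, hir], ?_⟩
    simp only [Category.assoc, reassoc_of% hri, hqj'', hqj']
  refine ⟨?_, transport (by simp [he]) (by simp [hfe]) (by simp [hef])⟩
  have := hf.add (transport (h := e - f) (by simp [he, hef, hfe, hff]) (by simp [hfe, hff])
    (by simp [hef, hff])) (by simp [hfe, hff]) (by simp [hef, hff])
  simpa using this

/-- `X` is an iterated binary direct sum of objects with local endomorphism rings. -/
inductive IsSumOfLocal : C → Prop
  | of_isZero {X : C} (hX : IsZero X) : IsSumOfLocal X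
  | of_add {X A B : C} (ι : A ⟶ X) (p : X ⟶ A) (ι' : B ⟶ X) (p' : X ⟶ B)
      (hιp : ι ≫ p = 𝟙 A) (hιp' : ι ≫ p' = 0) (hι'p : ι' ≫ p = 0) (hι'p' : ι' ≫ p' = 𝟙 B)
      (total : p ≫ ι + p' ≫ ι' = 𝟙 X) (hA : IsLocalRing (End A)) (hB : IsSumOfLocal B) :
      IsSumOfLocal X

lemma IsSumOfLocal.splits [HasBinaryBiproducts C] {X : C} (hX : IsSumOfLocal X) (e : X ⟶ X)
    (he : e ≫ e = e) : Splits e := by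
  induction hX with
  | of_isZero hX => exact ⟨_, 𝟙 _, 𝟙 _, by simp, hX.eq_of_src _ _⟩
  | @of_add X A B ι p ι' p' hιp hιp' hι'p hι'p' total hA hB ih =>
    let a : End A := ι ≫ e ≫ p
    let b : End A := ι ≫ (𝟙 X - e) ≫ p
    have hsum : a + b = 1 := by
      simp [a, b, hιp, End.one_def]
    rcases IsLocalRing.isUnit_or_isUnit_of_add_one hsum with h | h
    · have := (isUnit_iff_isIso (ι ≫ e ≫ p)).1 h
      exact (splits_and_splits_of_isIso hι'p hι'p' total ih he).1
    · have := (isUnit_iff_isIso (ι ≫ (𝟙 X - e) ≫ p)).1 h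
      simpa using (splits_and_splits_of_isIso hι'p hι'p' total ih
        (e := 𝟙 X - e) (by simp [he])).2

lemma IsSumOfLocal.of_iso {X Y : C} (hX : IsSumOfLocal X) (i : X ≅ Y) : IsSumOfLocal Y := by
  cases hX with
  | of_isZero hX => exact .of_isZero (hX.of_iso i.symm)
  | of_add ι p ι' p' hιp hιp' hι'p hι'p' total hA hB =>
    refine .of_add (ι ≫ i.hom) (i.inv ≫ p) (ι' ≫ i.hom) (i.inv ≫ p') (by simpa) (by simpa)
      (by simpa) (by simpa) ?_ hA hB
    have := i.inv ≫= total =≫ i.hom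
    simpa using this

lemma isSumOfLocal_biproduct [HasFiniteBiproducts C] {n : ℕ} (f : Fin n → C)
    (hf : ∀ i, IsLocalRing (End (f i))) : IsSumOfLocal (⨁ f) := by
  induction n with
  | zero =>
    refine .of_isZero ((IsZero.iff_id_eq_zero _).2 ?_)
    ext i
    exact i.elim0
  | succ n ih =>
    refine .of_add (biproduct.ι f 0) (biproduct.π f 0)
      (biproduct.desc fun i : Fin n => biproduct.ι f i.succ)
      (biproduct.lift fun i : Fin n => biproduct.π f i.succ) (by simp) ?_ ?_ ?_ ?_ (hf 0)
      (ih (fun i => f i.succ) fun i => hf i.succ)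
    · ext i
      simp [biproduct.ι_π_ne f (Fin.succ_ne_zero i).symm]
    · ext i
      simp [biproduct.ι_π_ne f (Fin.succ_ne_zero i)]
    · ext i k
      by_cases h : i = k
      · subst h; simp
      · simp [biproduct.ι_π_ne f (fun h' => h (Fin.succ_injective _ h').symm),
          biproduct.ι_π_ne _ (Ne.symm h)]
    · rw [biproduct.lift_desc, ← biproduct.total, Fin.sum_univ_succ]

lemma IsKrullSchmidt.isIdempotentComplete [HasFiniteBiproducts C] (hC : IsKrullSchmidt C) :
    IsIdempotentComplete C where
  idempotents_split X e he := by
    have : HasBinaryBiproducts C := hasBinaryBiproducts_of_finite_biproducts C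
    obtain ⟨n, f, ⟨i⟩, hf⟩ := hC X
    exact ((isSumOfLocal_biproduct f hf).of_iso i.symm).splits e he

end IdempotentSplitting

lemma exists_comp_eq_of_ker_le {R : Type*} [CommRing R] {E M N : Type*} [AddCommGroup E]
    [Module R E] [AddCommGroup M] [Module R M] [AddCommGroup N] [Module R N]
    (hE : Module.Baer R E) (g : M →ₗ[R] N) (ψ : M →ₗ[R] E)
    (h : LinearMap.ker g ≤ LinearMap.ker ψ) : ∃ ξ : N →ₗ[R] E, ξ ∘ₗ g = ψ := by
  obtain ⟨ξ, hξ⟩ := hE.extension_property ((LinearMap.ker g).liftQ g le_rfl)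
    (LinearMap.ker_eq_bot.1 (Submodule.ker_liftQ_eq_bot _ _ _ le_rfl))
    ((LinearMap.ker g).liftQ ψ h)
  refine ⟨ξ, LinearMap.ext fun m => ?_⟩
  simpa using LinearMap.congr_fun hξ (Submodule.Quotient.mk m)

section

variable {R : Type u} [CommRing R] {E : Type u} [AddCommGroup E] [Module R E]
variable {C : Type v} [Category.{w} C] [Preadditive C] [CategoryTheory.Linear R C]

lemma MemR.dHomRightCoherent [HasZeroObject C] {X : C} (h : MemR R E X) :
    DHomRightCoherent R E X := by
  obtain ⟨S, φ, hφ⟩ := h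
  refine ⟨0, S, 0, fun Y => (φ Y).symm.toLinearMap.toAddMonoidHom, fun Y Y' g h => ?_,
    fun Y t => ?_, fun Y => (φ Y).symm.surjective⟩
  · apply (φ Y').injective
    simp [hφ]
  · simp

lemma MemL.dHomLeftCoherent [HasZeroObject C] {X : C} (h : MemL R E X) :
    DHomLeftCoherent R E X := by
  obtain ⟨S, φ, hφ⟩ := h
  refine ⟨S, 0, 0, fun Y => (φ Y).symm.toLinearMap.toAddMonoidHom, fun Y Y' g h => ?_,
    fun Y t => ?_, fun Y => (φ Y).symm.surjective⟩
  · apply (φ Y').injective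
    simp [hφ]
  · simp

/-- A coherent functor `D Hom(X, -)` is representable when idempotents split and every morphism is
a pseudokernel. -/
lemma DHomRightCoherent.memR [IsIdempotentComplete C] (hE : Module.Baer R E)
    (hC : ∀ ⦃A B : C⦄ (f : A ⟶ B), ∃ (Q : C) (g : B ⟶ Q), IsPseudokernel f g)
    {X : C} (h : DHomRightCoherent R E X) : MemR R E X := by
  obtain ⟨C₀, C₁, f, π, nat, hexact, surj⟩ := h
  obtain ⟨C₂, g, hfg, hg⟩ := hC f
  have hπf {Y : C} (a : Y ⟶ C₀) : π Y (a ≫ f) = 0 := (hexact Y _).2 ⟨a, rfl⟩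
  obtain ⟨ξ, hξ⟩ := exists_comp_eq_of_ker_le hE (Linear.rightComp R X g) (π C₁ (𝟙 C₁)) (by
    intro x hx
    obtain ⟨t, rfl⟩ := hg x hx
    have := nat f (𝟙 C₁)
    rw [show f ≫ 𝟙 C₁ = 𝟙 C₀ ≫ f by simp, hπf] at this
    exact (LinearMap.congr_fun this t).symm)
  obtain ⟨s, rfl⟩ := surj _ ξ
  obtain ⟨k, hk⟩ := (hexact C₁ (𝟙 C₁ - g ≫ s)).1 (by rw [map_sub, nat, hξ, sub_self])
  dsimp only at hk
  have hk' : g ≫ s = 𝟙 C₁ - k ≫ f := by simp [hk]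
  obtain ⟨S, i, p, hip, hpi⟩ := IsIdempotentComplete.idempotents_split C₁ (g ≫ s) (by
    nth_rw 1 [hk']
    simp [reassoc_of% hfg])
  have hfp : f ≫ p = 0 := by
    have : f ≫ p ≫ i ≫ p = 0 := by rw [reassoc_of% hpi, reassoc_of% hfg, zero_comp]
    simpa [hip] using this
  have hπ {Y : C} (a : Y ⟶ C₁) : π Y (a ≫ p ≫ i) = π Y a := by
    rw [hpi, hk', Preadditive.comp_sub, Category.comp_id, map_sub, ← Category.assoc, hπf, sub_zero]
  let θ (Y : C) : (Y ⟶ S) →ₗ[R] ((X ⟶ Y) →ₗ[R] E) :=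
    { toFun t := π Y (t ≫ i)
      map_add' t t' := by simp
      map_smul' r t := by
        rw [show (r • t) ≫ i = (r • 𝟙 Y) ≫ t ≫ i by simp, nat]
        ext x
        simp }
  have hθ (Y : C) : Function.Bijective (θ Y) := by
    constructor
    · rw [injective_iff_map_eq_zero]
      intro t ht
      obtain ⟨a, ha⟩ := (hexact Y _).1 ht
      dsimp only at ha
      have := ha =≫ p
      simpa [hfp, hip] using this.symm
    · intro ψ
      obtain ⟨a, rfl⟩ := surj Y ψ
      exact ⟨a ≫ p, by simpa [θ] using hπ a⟩
  refine ⟨S, fun Y => (LinearEquiv.ofBijective (θ Y) (hθ Y)).symm, fun Y Y' a ψ => ?_⟩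
  rw [LinearEquiv.symm_apply_eq]
  obtain ⟨t, rfl⟩ := (hθ Y').2 ψ
  rw [← LinearEquiv.ofBijective_apply (θ Y') (hf := hθ Y') t, LinearEquiv.symm_apply_apply]
  simp [θ, ← nat]

/-- A coherent functor `D Hom(-, X)` is representable when idempotents split and every morphism is
a pseudocokernel. -/
lemma DHomLeftCoherent.memL [IsIdempotentComplete C] (hE : Module.Baer R E)
    (hC : ∀ ⦃A B : C⦄ (f : A ⟶ B), ∃ (K : C) (g : K ⟶ A), IsPseudocokernel g f)
    {X : C} (h : DHomLeftCoherent R E X) : MemL R E X := by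
  obtain ⟨C₀, C₁, f, π, nat, hexact, surj⟩ := h
  obtain ⟨C₂, g, hgf, hg⟩ := hC f
  have hπf {Y : C} (a : C₁ ⟶ Y) : π Y (f ≫ a) = 0 := (hexact Y _).2 ⟨a, rfl⟩
  obtain ⟨ξ, hξ⟩ := exists_comp_eq_of_ker_le hE (Linear.leftComp R X g) (π C₀ (𝟙 C₀)) (by
    intro x hx
    obtain ⟨t, rfl⟩ := hg x hx
    have := nat f (𝟙 C₀)
    rw [show 𝟙 C₀ ≫ f = f ≫ 𝟙 C₁ by simp, hπf] at this
    exact (LinearMap.congr_fun this t).symm)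
  obtain ⟨s, rfl⟩ := surj _ ξ
  obtain ⟨k, hk⟩ := (hexact C₀ (𝟙 C₀ - s ≫ g)).1 (by rw [map_sub, nat, hξ, sub_self])
  dsimp only at hk
  have hk' : s ≫ g = 𝟙 C₀ - f ≫ k := by simp [hk]
  obtain ⟨S, i, p, hip, hpi⟩ := IsIdempotentComplete.idempotents_split C₀ (s ≫ g) (by
    nth_rw 2 [hk']
    simp [reassoc_of% hgf])
  have hif : i ≫ f = 0 := by
    have : i ≫ p ≫ i ≫ f = 0 := by rw [reassoc_of% hpi, hgf, comp_zero, comp_zero]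
    simpa [reassoc_of% hip] using this
  have hπ {Y : C} (a : C₀ ⟶ Y) : π Y (p ≫ i ≫ a) = π Y a := by
    rw [reassoc_of% hpi, ← Category.assoc, hk', Preadditive.sub_comp, Category.id_comp, map_sub,
      Category.assoc, hπf, sub_zero]
  let θ (Y : C) : (S ⟶ Y) →ₗ[R] ((Y ⟶ X) →ₗ[R] E) :=
    { toFun t := π Y (p ≫ t)
      map_add' t t' := by simp
      map_smul' r t := by
        rw [show p ≫ (r • t) = (p ≫ t) ≫ (r • 𝟙 Y) by simp, nat]
        ext x
        simp }
  have hθ (Y : C) : Function.Bijective (θ Y) := by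
    constructor
    · rw [injective_iff_map_eq_zero]
      intro t ht
      obtain ⟨a, ha⟩ := (hexact Y _).1 ht
      dsimp only at ha
      have := i ≫= ha
      simpa [reassoc_of% hif, reassoc_of% hip] using this.symm
    · intro ψ
      obtain ⟨a, rfl⟩ := surj Y ψ
      exact ⟨i ≫ a, by simpa [θ] using hπ a⟩
  refine ⟨S, fun Y => (LinearEquiv.ofBijective (θ Y) (hθ Y)).symm, fun Y Y' a ψ => ?_⟩
  rw [LinearEquiv.symm_apply_eq]
  obtain ⟨t, rfl⟩ := (hθ Y).2 ψ
  rw [← LinearEquiv.ofBijective_apply (θ Y) (hf := hθ Y) t, LinearEquiv.symm_apply_apply]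
  simp [θ, ← nat]

end

section

variable {C : Type v} [Category.{w} C] [Preadditive C] [HasZeroObject C] [HasShift C ℤ]
  [∀ n : ℤ, (shiftFunctor C n).Additive] [Pretriangulated C]

lemma isPseudokernel_of_distTriang {T : Triangle C} (hT : T ∈ distTriang C) :
    IsPseudokernel T.mor₁ T.mor₂ :=
  ⟨comp_distTriang_mor_zero₁₂ _ hT, fun _ k hk =>
    (Triangle.coyoneda_exact₂ _ hT k hk).imp fun _ h => h.symm⟩

lemma isPseudocokernel_of_distTriang {T : Triangle C} (hT : T ∈ distTriang C) :
    IsPseudocokernel T.mor₁ T.mor₂ :=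
  ⟨comp_distTriang_mor_zero₁₂ _ hT, fun _ k hk =>
    (Triangle.yoneda_exact₂ _ hT k hk).imp fun _ h => h.symm⟩

end

/-- **Corollary 2.6**: a skeletally small Hom-finite Krull-Schmidt `R`-linear triangulated
category `T` has Serre duality if and only if `T` is a dualizing `R`-variety, i.e. `T` has
pseudokernels and pseudocokernels and the functors `D Hom(X, -)` and `D Hom(-, X)` are
coherent for every object `X`. -/
theorem serre_duality_iff_dualizing_variety
    (R : Type u) [CommRing R] [IsArtinianRing R]
    (E : Type u) [AddCommGroup E] [Module R E]
    (hE : IsMinimalInjectiveCogenerator R E)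
    (C : Type v) [Category.{w} C] [Preadditive C] [CategoryTheory.Linear R C]
    [HasZeroObject C] [HasShift C ℤ] [∀ n : ℤ, (shiftFunctor C n).Additive]
    [Pretriangulated C] [HasFiniteBiproducts C] [EssentiallySmall.{w} C]
    [∀ X Y : C, Module.Finite R (X ⟶ Y)]
    (hKS : IsKrullSchmidt C) :
    (∀ X : C, MemR R E X ∧ MemL R E X) ↔
    ((∀ ⦃A B : C⦄ (f : A ⟶ B), ∃ (K : C) (k : K ⟶ A), IsPseudokernel k f) ∧
     (∀ ⦃A B : C⦄ (f : A ⟶ B), ∃ (Q : C) (c : B ⟶ Q), IsPseudocokernel f c) ∧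
     (∀ X : C, DHomRightCoherent R E X) ∧
     (∀ X : C, DHomLeftCoherent R E X)) := by
  have hB : Module.Baer R E := Module.Baer.of_injective hE.injective
  have := hKS.isIdempotentComplete
  constructor
  · intro h
    refine ⟨fun A B f => ?_, fun A B f => ?_, fun X => (h X).1.dHomRightCoherent,
      fun X => (h X).2.dHomLeftCoherent⟩
    · obtain ⟨K, k, _, hT⟩ := distinguished_cocone_triangle₁ f
      exact ⟨K, k, isPseudokernel_of_distTriang hT⟩
    · obtain ⟨Q, c, _, hT⟩ := distinguished_cocone_triangle f
      exact ⟨Q, c, isPseudocokernel_of_distTriang hT⟩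
  · rintro ⟨-, -, hr, hl⟩ X
    refine ⟨(hr X).memR hB fun A B f => ?_, (hl X).memL hB fun A B f => ?_⟩
    · obtain ⟨Q, c, _, hT⟩ := distinguished_cocone_triangle f
      exact ⟨Q, c, isPseudokernel_of_distTriang hT⟩
    · obtain ⟨K, k, _, hT⟩ := distinguished_cocone_triangle₁ f
      exact ⟨K, k, isPseudocokernel_of_distTriang hT⟩

end GeneralizedSerreDuality
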